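/- Let F = F(x^1,…,x^N) satisfy the commutativity equations F_i F_j = F_j F_i for all i,j, suppose the matrix P = (F_{i₀ i j}) (rows i ≠ i₀) has rank N−1, and suppose there exist functions η^k with G = Σ_k η^k F_k non-degenerate. Then F is a solution of the WDVV equations F_i B^{-1} F_j = F_j B^{-1} F_i for all i,j = 1,…,N, where B is the (invertible) matrix with entries B_{ij} = Σ_k A^k F_{kij}, A^k = (−1)^{k+1} det P_k. -/

import Mathlib

open scoped BigOperators

noncomputable def pd {N : ℕ} (i : Fin N) (f : (Fin N → ℂ) → ℂ) : (Fin N → ℂ) → ℂ :=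
  fun x => fderiv ℂ f x (Pi.single i 1)

noncomputable def D3 {N : ℕ} (F : (Fin N → ℂ) → ℂ) (i p q : Fin N) (x : Fin N → ℂ) : ℂ :=
  pd i (pd p (pd q F)) x

noncomputable def Fmat {N : ℕ} (F : (Fin N → ℂ) → ℂ) (i : Fin N) (x : Fin N → ℂ) :
    Matrix (Fin N) (Fin N) ℂ :=
  Matrix.of fun p q => D3 F i p q x

/-- The `(N−1)×N` matrix `P = (F_{i₀ i j})` with rows indexed by `i ≠ i₀`
(in increasing order) and columns by `j = 1,…,N`. -/
noncomputable def Pmat {n : ℕ} (F : (Fin (n + 1) → ℂ) → ℂ) (i₀ : Fin (n + 1))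
    (x : Fin (n + 1) → ℂ) : Matrix (Fin n) (Fin (n + 1)) ℂ :=
  Matrix.of fun i j => D3 F i₀ (i₀.succAbove i) j x

/-- `A^k = (−1)^{k+1} det P_k` (with the 1-based sign convention of the paper,
so `(−1)^{k}` for the 0-based index `k`), where `P_k` is `P` with the `k`-th
column removed. -/
noncomputable def Acoef {n : ℕ} (F : (Fin (n + 1) → ℂ) → ℂ) (i₀ : Fin (n + 1))
    (x : Fin (n + 1) → ℂ) (k : Fin (n + 1)) : ℂ :=
  (-1 : ℂ) ^ (k : ℕ) *
    (Matrix.of fun i j : Fin n => Pmat F i₀ x i (k.succAbove j)).det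

/-- The matrix `B` with entries `B_{ij} = Σ_k A^k F_{kij}`. -/
noncomputable def Bmat {n : ℕ} (F : (Fin (n + 1) → ℂ) → ℂ) (i₀ : Fin (n + 1))
    (x : Fin (n + 1) → ℂ) : Matrix (Fin (n + 1)) (Fin (n + 1)) ℂ :=
  Matrix.of fun i j => ∑ k, Acoef F i₀ x k * D3 F k i j x

open Matrix

lemma contDiff_pd {N : ℕ} {f : (Fin N → ℂ) → ℂ} (hf : ContDiff ℂ ⊤ f) (i : Fin N) :
    ContDiff ℂ ⊤ (pd i f) :=
  (hf.fderiv_right (m := ⊤) le_top).clm_apply contDiff_const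

lemma pd_comm {N : ℕ} {f : (Fin N → ℂ) → ℂ} (hf : ContDiff ℂ ⊤ f) (i j : Fin N) :
    pd i (pd j f) = pd j (pd i f) := by
  funext x
  have hd : DifferentiableAt ℂ (fderiv ℂ f) x :=
    ((hf.fderiv_right (m := ⊤) le_top).differentiable (by simp)) x
  have hpd (a b : Fin N) :
      pd a (pd b f) x = fderiv ℂ (fderiv ℂ f) x (Pi.single a 1) (Pi.single b 1) := by
    unfold pd
    rw [fderiv_clm_apply hd (differentiableAt_const _)]
    simp
  have hsymm : IsSymmSndFDerivAt ℂ f x :=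
    hf.contDiffAt.isSymmSndFDerivAt (by simp)
  rw [hpd, hpd, hsymm.eq]

lemma D3_swap_left {N : ℕ} {F : (Fin N → ℂ) → ℂ} (hF : ContDiff ℂ ⊤ F) (i p q : Fin N)
    (x : Fin N → ℂ) : D3 F i p q x = D3 F p i q x :=
  congrFun (pd_comm (contDiff_pd hF q) i p) x

lemma D3_swap_right {N : ℕ} {F : (Fin N → ℂ) → ℂ} (hF : ContDiff ℂ ⊤ F) (i p q : Fin N)
    (x : Fin N → ℂ) : D3 F i p q x = D3 F i q p x := by
  unfold D3
  rw [pd_comm hF p q]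

section SymmetricTensor

variable {K : Type*} [Field K] {n : ℕ}

/-- A totally symmetric tensor moves a vector contracted with its first slot to the last one. -/
lemma sum_smul_mulVec_comm {M : Fin n → Matrix (Fin n) (Fin n) K}
    (hleft : ∀ i p q, M i p q = M p i q) (hright : ∀ i p q, M i p q = M i q p)
    (a v : Fin n → K) :
    (∑ k, a k • M k) *ᵥ v = (∑ k, v k • M k) *ᵥ a := by
  ext p
  simp only [mulVec, dotProduct, Matrix.sum_apply, Matrix.smul_apply, smul_eq_mul, Finset.sum_mul]
  rw [Finset.sum_comm]
  refine Finset.sum_congr rfl fun i _ => Finset.sum_congr rfl fun j _ => ?_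
  rw [hleft j p i, hright p j i, hleft p i j]
  ring

/-- If some combination of commuting slices is invertible and all rows of the slice `M i₀` but the
`i₀`-th are linearly independent, then that slice is invertible. -/
lemma det_slice_ne_zero {M : Fin (n + 1) → Matrix (Fin (n + 1)) (Fin (n + 1)) K}
    (hleft : ∀ i p q, M i p q = M p i q) (hright : ∀ i p q, M i p q = M i q p)
    (hcomm : ∀ i j, M i * M j = M j * M i) (i₀ : Fin (n + 1))
    (hrows : LinearIndependent K fun i : Fin n => M i₀ (i₀.succAbove i))
    {η : Fin (n + 1) → K} (hG : IsUnit (∑ k, η k • M k).det) :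
    (M i₀).det ≠ 0 := by
  intro hdet
  obtain ⟨u, hu0, hu⟩ := Matrix.exists_vecMul_eq_zero_iff.mpr hdet
  set G := ∑ k, η k • M k with hGdef
  have hcommG : M i₀ * G = G * M i₀ := by
    simp [hGdef, Finset.mul_sum, Finset.sum_mul, hcomm i₀]
  have hslice : M i₀ *ᵥ η = G *ᵥ Pi.single i₀ 1 := by
    rw [hGdef, sum_smul_mulVec_comm hleft hright]
    simp [Pi.single_apply]
  have hinv : G⁻¹ * G = 1 := Matrix.nonsing_inv_mul _ hG
  have hcommInv : G⁻¹ * M i₀ = M i₀ * G⁻¹ := by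
    calc G⁻¹ * M i₀ = G⁻¹ * (M i₀ * G) * G⁻¹ := by
          rw [Matrix.mul_assoc, Matrix.mul_assoc, Matrix.mul_nonsing_inv _ hG, Matrix.mul_one]
      _ = M i₀ * G⁻¹ := by
          rw [hcommG, ← Matrix.mul_assoc, hinv, Matrix.one_mul]
  have hui : u i₀ = 0 := by
    calc u i₀ = u ⬝ᵥ ((G⁻¹ * G) *ᵥ Pi.single i₀ 1) := by
          rw [hinv, Matrix.one_mulVec, dotProduct_single_one]
      _ = u ⬝ᵥ ((M i₀ * G⁻¹) *ᵥ η) := by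
          rw [← hcommInv, ← Matrix.mulVec_mulVec, ← Matrix.mulVec_mulVec, hslice]
      _ = 0 := by
          rw [← Matrix.mulVec_mulVec, Matrix.dotProduct_mulVec, hu, zero_dotProduct]
  refine hu0 (funext fun p => ?_)
  have hrel : ∑ i : Fin n, u (i₀.succAbove i) • M i₀ (i₀.succAbove i) = 0 := by
    have h := hu
    rw [Matrix.vecMul_eq_sum, Fin.sum_univ_succAbove _ i₀, hui] at h
    simpa using h
  rcases Fin.eq_self_or_eq_succAbove i₀ p with rfl | ⟨i, rfl⟩
  · exact hui
  · exact Fintype.linearIndependent_iff.mp hrows _ hrel i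

/-- Contracting the first slot of a symmetric tensor with commuting slices against a solution of
`M i₀ *ᵥ a = c • e_{i₀}` gives the scalar matrix `c`, provided the slice `M i₀` is invertible. -/
lemma sum_smul_eq_smul_one {M : Fin n → Matrix (Fin n) (Fin n) K}
    (hleft : ∀ i p q, M i p q = M p i q) (hright : ∀ i p q, M i p q = M i q p)
    (hcomm : ∀ i j, M i * M j = M j * M i) {i₀ : Fin n} (hdet : (M i₀).det ≠ 0)
    {a : Fin n → K} {c : K} (ha : M i₀ *ᵥ a = c • Pi.single i₀ 1) :
    ∑ k, a k • M k = c • (1 : Matrix (Fin n) (Fin n) K) := by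
  have hmul : M i₀ * (∑ k, a k • M k) = M i₀ * (c • 1) := by
    refine Matrix.ext_of_mulVec_single fun j => ?_
    have hv (v : Fin n → K) :
        (M i₀ * ∑ k, a k • M k) *ᵥ v = (M i₀ * (c • 1)) *ᵥ v := by
      have hcv : M i₀ * (∑ k, v k • M k) = (∑ k, v k • M k) * M i₀ := by
        simp [Finset.mul_sum, Finset.sum_mul, hcomm i₀]
      rw [← Matrix.mulVec_mulVec, sum_smul_mulVec_comm hleft hright, Matrix.mulVec_mulVec, hcv,
        ← Matrix.mulVec_mulVec, ha, Matrix.mulVec_smul, sum_smul_mulVec_comm hleft hright]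
      simp [Pi.single_apply, Matrix.smul_mulVec]
    exact hv _
  have hunit : IsUnit (M i₀) := (Matrix.isUnit_iff_isUnit_det _).mpr hdet.isUnit
  exact hunit.mul_left_cancel hmul

end SymmetricTensor

lemma linearIndependent_row_of_rank_eq {K : Type*} [Field K] {m n : ℕ}
    {P : Matrix (Fin m) (Fin n) K} (h : P.rank = m) : LinearIndependent K P.row := by
  rw [linearIndependent_iff_card_eq_finrank_span, Set.finrank, ← Matrix.rank_eq_finrank_span_row, h,
    Fintype.card_fin]

lemma Acoef_eq_adjugate {n : ℕ} (F : (Fin (n + 1) → ℂ) → ℂ) (i₀ : Fin (n + 1))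
    (x : Fin (n + 1) → ℂ) (k : Fin (n + 1)) :
    Acoef F i₀ x k = (-1 : ℂ) ^ (i₀ : ℕ) * (Fmat F i₀ x).adjugate k i₀ := by
  rw [Matrix.adjugate_fin_succ_eq_det_submatrix, ← mul_assoc, pow_add, ← mul_assoc,
    ← mul_pow, neg_one_mul, neg_neg, one_pow, one_mul]
  rfl

lemma Fmat_mulVec_Acoef {n : ℕ} (F : (Fin (n + 1) → ℂ) → ℂ) (i₀ : Fin (n + 1))
    (x : Fin (n + 1) → ℂ) :
    Fmat F i₀ x *ᵥ Acoef F i₀ x =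
      ((-1 : ℂ) ^ (i₀ : ℕ) * (Fmat F i₀ x).det) • Pi.single i₀ 1 := by
  have hA : Acoef F i₀ x =
      (-1 : ℂ) ^ (i₀ : ℕ) • ((Fmat F i₀ x).adjugate *ᵥ Pi.single i₀ 1) := by
    ext k
    simp [Acoef_eq_adjugate]
  rw [hA, Matrix.mulVec_smul, Matrix.mulVec_mulVec, Matrix.mul_adjugate, Matrix.smul_mulVec,
    Matrix.one_mulVec, smul_smul]

lemma Bmat_eq_sum {n : ℕ} (F : (Fin (n + 1) → ℂ) → ℂ) (i₀ : Fin (n + 1))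
    (x : Fin (n + 1) → ℂ) : Bmat F i₀ x = ∑ k, Acoef F i₀ x k • Fmat F k x := by
  ext i j
  simp [Bmat, Fmat, Matrix.sum_apply]

/-- under the same assumptions `B` is invertible and `F` solves
the WDVV equations `F_i B⁻¹ F_j = F_j B⁻¹ F_i`. -/
theorem stmt15 {n : ℕ} (F : (Fin (n + 1) → ℂ) → ℂ) (hF : ContDiff ℂ ⊤ F)
    (hcomm : ∀ x, ∀ i j : Fin (n + 1), Fmat F i x * Fmat F j x = Fmat F j x * Fmat F i x)
    (i₀ : Fin (n + 1)) (x : Fin (n + 1) → ℂ)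
    (hrank : (Pmat F i₀ x).rank = n)
    (η : Fin (n + 1) → ℂ)
    (hG : IsUnit (∑ k, η k • Fmat F k x).det) :
    IsUnit (Bmat F i₀ x).det ∧
    ∀ i j : Fin (n + 1),
      Fmat F i x * (Bmat F i₀ x)⁻¹ * Fmat F j x =
      Fmat F j x * (Bmat F i₀ x)⁻¹ * Fmat F i x := by
  have hleft (i p q : Fin (n + 1)) : Fmat F i x p q = Fmat F p x i q :=
    D3_swap_left hF i p q x
  have hright (i p q : Fin (n + 1)) : Fmat F i x p q = Fmat F i x q p :=
    D3_swap_right hF i p q x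
  have hdet : (Fmat F i₀ x).det ≠ 0 :=
    det_slice_ne_zero (M := fun k => Fmat F k x) hleft hright (hcomm x) i₀
      (linearIndependent_row_of_rank_eq hrank) hG
  obtain ⟨c, hc, hB⟩ : ∃ c : ℂ, c ≠ 0 ∧ Bmat F i₀ x = c • 1 :=
    ⟨_, mul_ne_zero (pow_ne_zero _ (by simp)) hdet, (Bmat_eq_sum F i₀ x).trans
      (sum_smul_eq_smul_one (M := fun k => Fmat F k x) hleft hright (hcomm x) hdet
        (Fmat_mulVec_Acoef F i₀ x))⟩
  have hBinv : (Bmat F i₀ x)⁻¹ = c⁻¹ • 1 :=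
    Matrix.inv_eq_left_inv (by simp [hB, smul_smul, hc])
  refine ⟨by simp [hB, hc], fun i j => ?_⟩
  simp [hBinv, hcomm x i j]
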